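/- arXiv:2310.00251 — 6 statements merged into one kernel-verified Lean document; each statement's English description precedes it below -/
import Mathlib

section
/- The direct sum graph Γ_{U⊕W}(V) is a complete graph if and only if dim V = 2. -/
/-- The direct sum graph `Γ_{U⊕W}(V)` of a vector space `V = U ⊕ W` over a field `F`,
with `dim U = r`, `dim W = s`, described in coordinates with respect to fixed bases
`{α_1,…,α_r}` of `U` and `{β_1,…,β_s}` of `W`: a vector `x` is identified with the pair
of its coefficient tuples `(a, b)`, the vertices are those `x` whose `U`-part and `W`-part
are both nonzero, and two distinct vertices are adjacent iff they share a basis vector of `U`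
with nonzero coefficient and a basis vector of `W` with nonzero coefficient. -/
def directSumGraph (F : Type*) [Field F] (r s : ℕ) :
    SimpleGraph {x : (Fin r → F) × (Fin s → F) // x.1 ≠ 0 ∧ x.2 ≠ 0} where
  Adj x y := x ≠ y ∧ (∃ i, x.val.1 i ≠ 0 ∧ y.val.1 i ≠ 0) ∧
    (∃ j, x.val.2 j ≠ 0 ∧ y.val.2 j ≠ 0)
  symm := by
    refine ⟨?_⟩
    rintro x y ⟨hxy, ⟨i, hi1, hi2⟩, ⟨j, hj1, hj2⟩⟩
    exact ⟨hxy.symm, ⟨i, hi2, hi1⟩, ⟨j, hj2, hj1⟩⟩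
  loopless := by refine ⟨?_⟩; rintro x ⟨hx, -⟩; exact hx rfl

/-- The direct sum graph is complete iff `dim V = 2`. -/
theorem directSumGraph_complete_iff (F : Type*) [Field F] (r s : ℕ)
    (hr : 1 ≤ r) (hs : 1 ≤ s) :
    directSumGraph F r s = ⊤ ↔ r + s = 2 := by
  constructor
  · intro h
    by_contra hne
    have h1 : (1 : F) ≠ 0 := one_ne_zero
    let i0 : Fin r := ⟨0, hr⟩
    let j0 : Fin s := ⟨0, hs⟩
    have hsr : ∀ (m : ℕ) (k : Fin m), (Pi.single k (1 : F) : Fin m → F) ≠ 0 := by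
      intro m k hk
      have := congrFun hk k
      simp at this
    have key : ∀ (m : ℕ) (a b i : Fin m), a ≠ b →
        (Pi.single a (1 : F) : Fin m → F) i ≠ 0 →
        (Pi.single b (1 : F) : Fin m → F) i ≠ 0 → False := by
      intro m a b i hab ha hb
      by_cases hia : i = a
      · subst hia
        exact hb (Pi.single_eq_of_ne hab _)
      · exact ha (Pi.single_eq_of_ne hia _)
    have main : ∀ (a b : Fin r) (c d : Fin s), (a ≠ b ∨ c ≠ d) → False := by
      intro a b c d hor
      let x : {x : (Fin r → F) × (Fin s → F) // x.1 ≠ 0 ∧ x.2 ≠ 0} :=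
        ⟨(Pi.single a 1, Pi.single c 1), hsr _ _, hsr _ _⟩
      let y : {x : (Fin r → F) × (Fin s → F) // x.1 ≠ 0 ∧ x.2 ≠ 0} :=
        ⟨(Pi.single b 1, Pi.single d 1), hsr _ _, hsr _ _⟩
      have hxy : x ≠ y := by
        intro e
        have e1 : (Pi.single a (1 : F) : Fin r → F) = Pi.single b 1 :=
          congrArg (fun z => z.val.1) e
        have e2 : (Pi.single c (1 : F) : Fin s → F) = Pi.single d 1 :=
          congrArg (fun z => z.val.2) e
        rcases hor with hab | hcd
        · exact key r a b a hab (by simp) (by rw [← e1]; simp)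
        · exact key s c d c hcd (by simp) (by rw [← e2]; simp)
      have hadj : (directSumGraph F r s).Adj x y := by
        rw [h]
        exact hxy
      obtain ⟨-, ⟨i, hi1, hi2⟩, ⟨j, hj1, hj2⟩⟩ := hadj
      rcases hor with hab | hcd
      · exact key r a b i hab hi1 hi2
      · exact key s c d j hcd hj1 hj2
    by_cases h2 : 2 ≤ r
    · exact main i0 ⟨1, h2⟩ j0 j0 (Or.inl (by simp [i0]))
    · have h3 : 2 ≤ s := by omega
      exact main i0 i0 j0 ⟨1, h3⟩ (Or.inr (by simp [j0]))
  · intro h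
    obtain rfl : r = 1 := by omega
    obtain rfl : s = 1 := by omega
    have nz : ∀ f : Fin 1 → F, f ≠ 0 → f 0 ≠ 0 := by
      intro f hf h0
      apply hf
      funext i
      rw [Subsingleton.elim i 0, h0]
      rfl
    ext x y
    rw [SimpleGraph.top_adj]
    constructor
    · intro hxy
      exact hxy.1
    · intro hxy
      exact ⟨hxy, ⟨0, nz _ x.2.1, nz _ y.2.1⟩, ⟨0, nz _ x.2.2, nz _ y.2.2⟩⟩
end

section
/- The minimum degree δ of Γ_{U⊕W}(V) equals (q − 1)²q^{n−2} − 1. -/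
noncomputable instance {F : Type*} [Field F] {r s : ℕ} :
    DecidableRel (directSumGraph F r s).Adj := Classical.decRel _


open Classical in
/-- Vectors whose support meets that of `a`. -/
noncomputable def meetSet {F : Type*} [Field F] [Fintype F] {r : ℕ} (a : Fin r → F) :
    Finset (Fin r → F) := Finset.univ.filter (fun y => ∃ i, a i ≠ 0 ∧ y i ≠ 0)

open Classical in
lemma card_coord {F : Type*} [Field F] [Fintype F] {r : ℕ} (i : Fin r) :
    (Finset.univ.filter (fun y : Fin r → F => y i ≠ 0)).card
      = (Fintype.card F - 1) * Fintype.card F ^ (r - 1) := by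
  have h : (Finset.univ.filter (fun y : Fin r → F => y i ≠ 0))
      = Fintype.piFinset (fun j => if j = i then Finset.univ.erase (0 : F) else Finset.univ) := by
    ext y
    simp only [Finset.mem_filter, Finset.mem_univ, true_and, Fintype.mem_piFinset]
    constructor
    · intro hy j
      by_cases hj : j = i
      · subst hj; simpa using hy
      · simp [hj]
    · intro hy
      simpa using hy i
  rw [h, Fintype.card_piFinset, ← Finset.mul_prod_erase _ _ (Finset.mem_univ i)]
  congr 1
  · simp [Finset.card_erase_of_mem, Finset.card_univ]
  · rw [Finset.prod_congr rfl (g := fun _ => Fintype.card F)]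
    · simp [Finset.card_erase_of_mem]
    · intro j hj
      simp [Finset.ne_of_mem_erase hj, Finset.card_univ]

lemma le_card_meetSet {F : Type*} [Field F] [Fintype F] {r : ℕ} (a : Fin r → F) (ha : a ≠ 0) :
    (Fintype.card F - 1) * Fintype.card F ^ (r - 1) ≤ (meetSet a).card := by
  classical
  obtain ⟨i, hi⟩ := Function.ne_iff.1 ha
  rw [← card_coord i]
  apply Finset.card_le_card
  intro y hy
  simp only [meetSet, Finset.mem_filter, Finset.mem_univ, true_and] at hy ⊢
  exact ⟨i, hi, hy⟩

lemma card_meetSet_single {F : Type*} [Field F] [Fintype F] {r : ℕ} (i : Fin r) :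
    (meetSet (Pi.single i (1 : F))).card = (Fintype.card F - 1) * Fintype.card F ^ (r - 1) := by
  classical
  rw [← card_coord i]
  congr 1
  ext y
  simp [meetSet, Pi.single_apply]

lemma degree_eq (F : Type*) [Field F] [Fintype F] [DecidableEq F] (r s : ℕ)
    (x : {x : (Fin r → F) × (Fin s → F) // x.1 ≠ 0 ∧ x.2 ≠ 0}) :
    (directSumGraph F r s).degree x
      = (meetSet x.val.1).card * (meetSet x.val.2).card - 1 := by
  have hx : x.val ∈ meetSet x.val.1 ×ˢ meetSet x.val.2 := by
    obtain ⟨i, hi⟩ := Function.ne_iff.1 x.2.1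
    obtain ⟨j, hj⟩ := Function.ne_iff.1 x.2.2
    simp only [meetSet, Finset.mem_product, Finset.mem_filter, Finset.mem_univ, true_and]
    exact ⟨⟨i, hi, hi⟩, ⟨j, hj, hj⟩⟩
  rw [← Finset.card_product, ← Finset.card_erase_of_mem hx, ← SimpleGraph.card_neighborFinset_eq_degree,
    ← Finset.card_map (Function.Embedding.subtype _)]
  congr 1
  ext y
  simp only [Finset.mem_map, SimpleGraph.mem_neighborFinset, Finset.mem_erase, Finset.mem_product,
    meetSet, Finset.mem_filter, Finset.mem_univ, true_and, Function.Embedding.subtype_apply]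
  constructor
  · rintro ⟨z, ⟨h1, h2, h3⟩, rfl⟩
    exact ⟨fun h => h1 (Subtype.ext h.symm), h2, h3⟩
  · rintro ⟨h1, ⟨i, hi, hi'⟩, ⟨j, hj, hj'⟩⟩
    refine ⟨⟨y, Function.ne_iff.2 ⟨i, hi'⟩, Function.ne_iff.2 ⟨j, hj'⟩⟩,
      ⟨fun h => h1 (congrArg Subtype.val h).symm, ⟨i, hi, hi'⟩, ⟨j, hj, hj'⟩⟩, rfl⟩

/-- The minimum degree of the direct sum graph is `(q − 1)² q^{n−2} − 1`. -/
theorem directSumGraph_minDegree (F : Type*) [Field F] [Fintype F] [DecidableEq F]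
    (q r s : ℕ) (hr : 1 ≤ r) (hs : 1 ≤ s) (hq : Fintype.card F = q) :
    (directSumGraph F r s).minDegree = (q - 1) ^ 2 * q ^ (r + s - 2) - 1 := by
  subst hq
  have key : (Fintype.card F - 1) ^ 2 * Fintype.card F ^ (r + s - 2)
      = ((Fintype.card F - 1) * Fintype.card F ^ (r - 1))
        * ((Fintype.card F - 1) * Fintype.card F ^ (s - 1)) := by
    have : r + s - 2 = (r - 1) + (s - 1) := by omega
    rw [this, pow_add]; ring
  rw [key]
  let x : {x : (Fin r → F) × (Fin s → F) // x.1 ≠ 0 ∧ x.2 ≠ 0} :=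
    ⟨(Pi.single ⟨0, hr⟩ 1, Pi.single ⟨0, hs⟩ 1), by simp, by simp⟩
  haveI : Nonempty {x : (Fin r → F) × (Fin s → F) // x.1 ≠ 0 ∧ x.2 ≠ 0} := ⟨x⟩
  apply le_antisymm
  · refine (SimpleGraph.minDegree_le_degree _ x).trans ?_
    rw [degree_eq, card_meetSet_single, card_meetSet_single]
  · apply SimpleGraph.le_minDegree_of_forall_le_degree
    intro y
    rw [degree_eq]
    exact Nat.sub_le_sub_right
      (Nat.mul_le_mul (le_card_meetSet _ y.2.1) (le_card_meetSet _ y.2.2)) 1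
end

section
/- The edge connectivity of Γ_{U⊕W}(V) (the minimum cardinality of a set of edges whose removal disconnects the graph) equals (q − 1)²q^{n−2} − 1. -/
/-- The edge connectivity of a graph: the minimum cardinality of a set of edges whose
removal disconnects the graph. -/
noncomputable def edgeConnectivity {V : Type*} (G : SimpleGraph V) : ℕ :=
  sInf {k | ∃ E : Finset (Sym2 V), ↑E ⊆ G.edgeSet ∧ E.card = k ∧
    ¬ (G.deleteEdges ↑E).Connected}

theorem aux_lower {V : Type*} (G : SimpleGraph V) (u : V)
    (hu : ∀ v, v ≠ u → G.Adj u v) (d : ℕ)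
    (hd : ∀ v, ∃ N : Finset V, (∀ w ∈ N, G.Adj v w) ∧ d ≤ N.card)
    (E : Finset (Sym2 V)) (hE : ¬ (G.deleteEdges (↑E : Set (Sym2 V))).Connected) : d ≤ E.card := by
  classical
  have h1 : ∃ v, ¬ (G.deleteEdges (↑E : Set (Sym2 V))).Reachable u v := by
    by_contra hcon
    push Not at hcon
    apply hE
    have : Nonempty V := ⟨u⟩
    exact ⟨fun a b => (hcon a).symm.trans (hcon b)⟩
  obtain ⟨v, hv⟩ := h1
  obtain ⟨N, hN, hc⟩ := hd v
  refine hc.trans ?_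
  have key : ∀ a b, (G.deleteEdges (↑E : Set (Sym2 V))).Reachable u a →
      ¬ (G.deleteEdges (↑E : Set (Sym2 V))).Reachable u b → G.Adj a b → s(a, b) ∈ E := by
    intro a b ha hb hab
    by_contra hn
    apply hb
    refine ha.trans (SimpleGraph.Adj.reachable ?_)
    rw [SimpleGraph.deleteEdges_adj]
    exact ⟨hab, by simpa using hn⟩
  have hvu : v ≠ u := fun h => hv (h ▸ SimpleGraph.Reachable.refl _)
  refine Finset.card_le_card_of_injOn
    (fun w => if (G.deleteEdges (↑E : Set (Sym2 V))).Reachable u w then s(w, v) else s(u, w)) ?_ ?_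
  · intro w hw
    have hw' := hN w hw
    by_cases h : (G.deleteEdges (↑E : Set (Sym2 V))).Reachable u w
    · simpa [h] using key w v h hv hw'.symm
    · simp only [h, if_false]
      exact key u w (SimpleGraph.Reachable.refl _) h
        (hu w (fun h' => h (h' ▸ SimpleGraph.Reachable.refl _)))
  · intro w hw w' hw' heq
    have n1 := (hN w hw).ne
    have n2 := (hN w' hw').ne
    by_cases h : (G.deleteEdges (↑E : Set (Sym2 V))).Reachable u w <;>
    by_cases h' : (G.deleteEdges (↑E : Set (Sym2 V))).Reachable u w' <;>
    simp only [h, h', if_true, if_false, Sym2.eq_iff] at heq <;> grind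

theorem aux_upper {V : Type*} (G : SimpleGraph V) (v w : V) (hvw : w ≠ v)
    (N : Finset V) (hN : ∀ w, w ∈ N ↔ G.Adj v w) :
    ∃ E : Finset (Sym2 V), ↑E ⊆ G.edgeSet ∧ E.card ≤ N.card ∧
    ¬ (G.deleteEdges (↑E : Set (Sym2 V))).Connected := by
  classical
  refine ⟨N.image (fun w => s(v, w)), ?_, Finset.card_image_le, ?_⟩
  · intro e he
    simp only [Finset.coe_image, Set.mem_image] at he
    obtain ⟨x, hx, rfl⟩ := he
    exact (hN x).1 hx
  · intro hc
    obtain ⟨p⟩ := hc.preconnected v w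
    cases p with
    | nil => exact hvw rfl
    | cons h p =>
      rw [SimpleGraph.deleteEdges_adj] at h
      apply h.2
      simp only [Finset.coe_image, Set.mem_image]
      exact ⟨_, (hN _).2 h.1, rfl⟩

theorem aux_card (F : Type*) [Field F] [Fintype F] [DecidableEq F] (r : ℕ) (i : Fin r) :
    (Finset.univ.filter (fun c : Fin r → F => c i ≠ 0)).card
      = (Fintype.card F - 1) * Fintype.card F ^ (r - 1) := by
  have : (Finset.univ.filter (fun c : Fin r → F => c i ≠ 0)) =
      Fintype.piFinset (fun k => if k = i then Finset.univ.erase (0 : F) else Finset.univ) := by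
    ext c
    simp only [Finset.mem_filter, Finset.mem_univ, true_and, Fintype.mem_piFinset]
    constructor
    · intro h k
      by_cases hk : k = i
      · subst hk; simpa using h
      · simp [hk]
    · intro h
      simpa using h i
  rw [this, Fintype.card_piFinset, ← Finset.mul_prod_erase _ _ (Finset.mem_univ i)]
  congr 1
  · simp [Finset.card_erase_of_mem]
  · rw [Finset.prod_congr rfl (g := fun _ => Fintype.card F)]
    · simp [Finset.card_erase_of_mem]
    · intro k hk
      simp [Finset.ne_of_mem_erase hk]

theorem aux_nbr (F : Type*) [Field F] [Fintype F] [DecidableEq F] (r s : ℕ)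
    (i : Fin r) (j : Fin s) (x : {x : (Fin r → F) × (Fin s → F) // x.1 ≠ 0 ∧ x.2 ≠ 0})
    (hi : x.val.1 i ≠ 0) (hj : x.val.2 j ≠ 0) :
    ∃ N : Finset {x : (Fin r → F) × (Fin s → F) // x.1 ≠ 0 ∧ x.2 ≠ 0},
      (∀ w, w ∈ N ↔ x ≠ w ∧ w.val.1 i ≠ 0 ∧ w.val.2 j ≠ 0) ∧
      N.card = (Fintype.card F - 1) ^ 2 * Fintype.card F ^ (r + s - 2) - 1 := by
  classical
  refine ⟨(((Finset.univ.filter (fun c : Fin r → F => c i ≠ 0)) ×ˢ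
    (Finset.univ.filter (fun c : Fin s → F => c j ≠ 0))).subtype _).erase x, ?_, ?_⟩
  · intro w
    simp [eq_comm]
  · rw [Finset.card_erase_of_mem (by simp [hi, hj]), Finset.card_subtype,
      Finset.filter_true_of_mem, Finset.card_product, aux_card, aux_card]
    · have h1 := i.pos
      have h2 := j.pos
      rw [show r + s - 2 = (r - 1) + (s - 1) by omega, pow_add]
      congr 1
      ring
    · intro y hy
      simp only [Finset.mem_product, Finset.mem_filter, Finset.mem_univ, true_and] at hy
      exact ⟨fun h => hy.1 (by simp [h]), fun h => hy.2 (by simp [h])⟩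

/-- The edge connectivity of the direct sum graph is `(q − 1)² q^{n−2} − 1`. -/
theorem directSumGraph_edgeConnectivity (F : Type*) [Field F] [Fintype F] [DecidableEq F]
    (q r s : ℕ) (hr : 1 ≤ r) (hs : 1 ≤ s) (hq : Fintype.card F = q) :
    edgeConnectivity (directSumGraph F r s) = (q - 1) ^ 2 * q ^ (r + s - 2) - 1 := by
  classical
  subst hq
  let i₀ : Fin r := ⟨0, hr⟩
  let j₀ : Fin s := ⟨0, hs⟩
  let v : {x : (Fin r → F) × (Fin s → F) // x.1 ≠ 0 ∧ x.2 ≠ 0} :=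
    ⟨(Pi.single i₀ 1, Pi.single j₀ 1), by simp, by simp⟩
  let u : {x : (Fin r → F) × (Fin s → F) // x.1 ≠ 0 ∧ x.2 ≠ 0} :=
    ⟨(fun _ => 1, fun _ => 1), fun h => one_ne_zero (congrFun h i₀),
      fun h => one_ne_zero (congrFun h j₀)⟩
  obtain ⟨N, hN, hNc⟩ := aux_nbr F r s i₀ j₀ v (by simp [v]) (by simp [v])
  have hN' : ∀ w, w ∈ N ↔ (directSumGraph F r s).Adj v w := by
    intro w
    rw [hN]
    refine and_congr_right fun _ => and_congr ?_ ?_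
    · constructor
      · intro h; exact ⟨i₀, by simp [v], h⟩
      · rintro ⟨i, h1, h2⟩
        by_cases h : i = i₀
        · exact h ▸ h2
        · simp [v, h] at h1
    · constructor
      · intro h; exact ⟨j₀, by simp [v], h⟩
      · rintro ⟨i, h1, h2⟩
        by_cases h : i = j₀
        · exact h ▸ h2
        · simp [v, h] at h1
  have hlow : ∀ E : Finset (Sym2 {x : (Fin r → F) × (Fin s → F) // x.1 ≠ 0 ∧ x.2 ≠ 0}),
      ¬ ((directSumGraph F r s).deleteEdges ↑E).Connected →
      N.card ≤ E.card := by
    intro E hE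
    refine aux_lower (directSumGraph F r s) u ?_ _ ?_ E hE
    · intro w hw
      obtain ⟨i, hi⟩ := Function.ne_iff.1 w.2.1
      obtain ⟨j, hj⟩ := Function.ne_iff.1 w.2.2
      exact ⟨hw.symm, ⟨i, by simp [u], hi⟩, ⟨j, by simp [u], hj⟩⟩
    · intro w
      obtain ⟨i, hi⟩ := Function.ne_iff.1 w.2.1
      obtain ⟨j, hj⟩ := Function.ne_iff.1 w.2.2
      obtain ⟨M, hM, hMc⟩ := aux_nbr F r s i j w hi hj
      refine ⟨M, ?_, by rw [hNc, hMc]⟩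
      intro y hy
      obtain ⟨h1, h2, h3⟩ := (hM y).1 hy
      exact ⟨h1, ⟨i, hi, h2⟩, ⟨j, hj, h3⟩⟩
  rw [← hNc]
  unfold edgeConnectivity
  by_cases hw : ∃ w, w ≠ v
  · obtain ⟨w, hw⟩ := hw
    obtain ⟨E, h1, h2, h3⟩ := aux_upper _ v w hw N hN'
    apply le_antisymm
    · refine le_trans (Nat.sInf_le ?_) h2
      exact ⟨E, h1, rfl, h3⟩
    · refine le_csInf ⟨_, E, h1, rfl, h3⟩ ?_
      rintro k ⟨E', -, rfl, h⟩
      exact hlow E' h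
  · push Not at hw
    have hN0 : N = ∅ := by
      refine Finset.eq_empty_of_forall_notMem fun w h => ?_
      exact ((hN w).1 h).1 (hw w).symm
    rw [hN0, Finset.card_empty, Nat.sInf_eq_zero]
    right
    refine Set.eq_empty_of_forall_notMem ?_
    rintro k ⟨E, -, -, h⟩
    apply h
    have : Nonempty {x : (Fin r → F) × (Fin s → F) // x.1 ≠ 0 ∧ x.2 ≠ 0} := ⟨v⟩
    refine ⟨fun a b => ?_⟩
    rw [hw a, hw b]
end

section
/- If n = dim V ≥ 4, then Γ_{U⊕W}(V) is triangulated: for every vertex x there exist vertices y and z such that x, y, z form a triangle (x ∼ y, y ∼ z, z ∼ x). -/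
/-- If `n = dim V ≥ 4`, the direct sum graph is triangulated: every vertex lies in a
triangle. -/
theorem directSumGraph_triangulated_of_four_le (F : Type*) [Field F] [Fintype F]
    (r s : ℕ) (hr : 1 ≤ r) (hs : 1 ≤ s) (hn : 4 ≤ r + s) :
    ∀ x, ∃ y z, (directSumGraph F r s).Adj x y ∧ (directSumGraph F r s).Adj y z ∧
      (directSumGraph F r s).Adj z x := by
  classical
  rintro ⟨⟨a, b⟩, ha, hb⟩
  obtain ⟨i, hi⟩ := Function.ne_iff.mp ha
  obtain ⟨j, hj⟩ := Function.ne_iff.mp hb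
  simp only [Pi.zero_apply] at hi hj
  have hc : 1 < ((Finset.univ : Finset (Fin r ⊕ Fin s)) \ {Sum.inl i, Sum.inr j}).card := by
    have h1 := Finset.le_card_sdiff ({Sum.inl i, Sum.inr j} : Finset (Fin r ⊕ Fin s)) Finset.univ
    have h2 : ({Sum.inl i, Sum.inr j} : Finset (Fin r ⊕ Fin s)).card ≤ 2 := Finset.card_le_two
    simp only [Finset.card_univ, Fintype.card_sum, Fintype.card_fin] at h1
    omega
  obtain ⟨p, hp, q, hq, hpq⟩ := Finset.one_lt_card.mp hc
  simp only [Finset.mem_sdiff, Finset.mem_univ, true_and, Finset.mem_insert,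
    Finset.mem_singleton, not_or] at hp hq
  let g : Fin r ⊕ Fin s → F := Sum.elim a b
  let t : Fin r ⊕ Fin s → Fin r ⊕ Fin s → F :=
    fun p => Function.update g p (if g p = 0 then 1 else 0)
  have ht : ∀ p, t p p ≠ g p := by
    intro p
    simp only [t, Function.update_self]
    split_ifs with h
    · rw [h]; exact one_ne_zero
    · exact fun h' => h h'.symm
  have ht' : ∀ p k, k ≠ p → t p k = g k := fun p k h => Function.update_of_ne h _ _
  have hpi : t p (Sum.inl i) ≠ 0 := by rw [ht' _ _ (Ne.symm hp.1)]; exact hi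
  have hpj : t p (Sum.inr j) ≠ 0 := by rw [ht' _ _ (Ne.symm hp.2)]; exact hj
  have hqi : t q (Sum.inl i) ≠ 0 := by rw [ht' _ _ (Ne.symm hq.1)]; exact hi
  have hqj : t q (Sum.inr j) ≠ 0 := by rw [ht' _ _ (Ne.symm hq.2)]; exact hj
  have key : ∀ f f' : Fin r ⊕ Fin s → F, f ≠ f' →
      ((fun i => f (Sum.inl i), fun j => f (Sum.inr j)) : (Fin r → F) × (Fin s → F)) ≠
        (fun i => f' (Sum.inl i), fun j => f' (Sum.inr j)) := by
    intro f f' h h'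
    apply h
    rw [Prod.mk.injEq] at h'
    funext k
    rcases k with k | k
    · exact congrFun h'.1 k
    · exact congrFun h'.2 k
  refine ⟨⟨(fun i => t p (Sum.inl i), fun j => t p (Sum.inr j)),
      fun h => hpi (congrFun h i), fun h => hpj (congrFun h j)⟩,
    ⟨(fun i => t q (Sum.inl i), fun j => t q (Sum.inr j)),
      fun h => hqi (congrFun h i), fun h => hqj (congrFun h j)⟩,
    ⟨?_, ⟨i, hi, hpi⟩, ⟨j, hj, hpj⟩⟩, ⟨?_, ⟨i, hpi, hqi⟩, ⟨j, hpj, hqj⟩⟩,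
    ⟨?_, ⟨i, hqi, hi⟩, ⟨j, hqj, hj⟩⟩⟩
  · intro h
    exact key g (t p) (fun e => ht p (congrFun e p).symm) (Subtype.ext_iff.mp h)
  · intro h
    exact key (t p) (t q) (fun e => ht p ((congrFun e p).trans (ht' q p hpq)))
      (Subtype.ext_iff.mp h)
  · intro h
    exact key (t q) g (fun e => ht q (congrFun e q)) (Subtype.ext_iff.mp h)
end

section
/- If q ≥ 3 and either n = 2, or n = 3 with dim W = 2 (so dim U = 1), then Γ_{U⊕W}(V) is triangulated: every vertex lies in a triangle. -/
/-- If `q ≥ 3` and either `n = 2` (so `dim U = dim W = 1`), or `n = 3` with `dim U = 1`,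
`dim W = 2`, the direct sum graph is triangulated: every vertex lies in a triangle. -/
theorem directSumGraph_triangulated_small (F : Type*) [Field F] [Fintype F]
    (q r s : ℕ) (hq : Fintype.card F = q) (hq3 : 3 ≤ q)
    (hrs : (r = 1 ∧ s = 1) ∨ (r = 1 ∧ s = 2)) :
    ∀ x, ∃ y z, (directSumGraph F r s).Adj x y ∧ (directSumGraph F r s).Adj y z ∧
      (directSumGraph F r s).Adj z x := by
  rintro ⟨⟨a, b⟩, ha, hb⟩
  obtain ⟨c, hc0, hc1⟩ : ∃ c : F, c ≠ 0 ∧ c ≠ 1 := by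
    classical
    have h : ({0, 1} : Finset F).card < Fintype.card F :=
      lt_of_le_of_lt Finset.card_le_two (by omega)
    obtain ⟨c, hc⟩ := Finset.exists_mem_notMem_of_card_lt_card
      (s := ({0, 1} : Finset F)) (t := Finset.univ) (by simpa using h)
    refine ⟨c, ?_, ?_⟩ <;> rintro rfl <;> simp at hc
  obtain ⟨i, hi⟩ := Function.ne_iff.mp ha
  obtain ⟨j, hj⟩ := Function.ne_iff.mp hb
  simp only [Pi.zero_apply] at hi hj
  have key : ∀ t : F, t ≠ 0 → c * t ≠ t := by
    intro t ht h
    exact hc1 (mul_right_cancel₀ ht (by rw [h, one_mul]))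
  refine ⟨⟨(c • a, b), smul_ne_zero hc0 ha, hb⟩, ⟨(a, c • b), ha, smul_ne_zero hc0 hb⟩,
    ⟨?_, ⟨i, hi, mul_ne_zero hc0 hi⟩, ⟨j, hj, hj⟩⟩,
    ⟨?_, ⟨i, mul_ne_zero hc0 hi, hi⟩, ⟨j, hj, mul_ne_zero hc0 hj⟩⟩,
    ⟨?_, ⟨i, hi, hi⟩, ⟨j, mul_ne_zero hc0 hj, hj⟩⟩⟩
  · intro h
    exact key _ hi (congrFun (congrArg (fun x => x.val.1) h) i).symm
  · intro h
    exact key _ hi (congrFun (congrArg (fun x => x.val.1) h) i)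
  · intro h
    exact key _ hj (congrFun (congrArg (fun x => x.val.2) h) j)
end

section
/- Fix integers k₁, k₂ with 1 ≤ k₁ ≤ r/2 and 1 ≤ k₂ ≤ s/2, and fix indices i ∈ {1,…,r}, j ∈ {1,…,s}. Then the set M = {x vertex of Γ_{U⊕W}(V) : i ∈ S_x^U, j ∈ S_x^W, |S_x^U| ≥ k₁ and |S_x^W| ≥ k₂} is a clique of Γ_{U⊕W}(V), and |M| = (q−1)² · Σ_{a=k₁−1}^{r−1} Σ_{b=k₂−1}^{s−1} C(r−1, a) C(s−1, b) (q−1)^{a+b}. -/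
theorem aux_count (F : Type*) [Field F] [Fintype F] [DecidableEq F]
    (r k : ℕ) (hk : 1 ≤ k) (i : Fin r) :
    (Finset.univ.filter fun v : Fin r → F => v i ≠ 0 ∧
      k ≤ (Finset.univ.filter fun a => v a ≠ 0).card).card =
    (Fintype.card F - 1) * ∑ a ∈ Finset.Icc (k - 1) (r - 1),
      (r - 1).choose a * (Fintype.card F - 1) ^ a := by
  classical
  have hr : 0 < r := i.pos
  have fib : ∀ S : Finset (Fin r),
      (Finset.univ.filter fun v : Fin r → F =>
        (Finset.univ.filter fun a => v a ≠ 0) = S).card = (Fintype.card F - 1) ^ S.card := by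
    intro S
    have : (Finset.univ.filter fun v : Fin r → F =>
        (Finset.univ.filter fun a => v a ≠ 0) = S) =
        Fintype.piFinset (fun a => if a ∈ S then Finset.univ.erase (0 : F) else {0}) := by
      ext v
      simp only [Finset.mem_filter, Finset.mem_univ, true_and, Fintype.mem_piFinset,
        Finset.ext_iff]
      refine forall_congr' fun a => ?_
      by_cases h : a ∈ S <;> simp [h]
    rw [this, Fintype.card_piFinset]
    have h2 : ∀ a, (if a ∈ S then Finset.univ.erase (0 : F) else {0}).card =
        if a ∈ S then Fintype.card F - 1 else 1 := by
      intro a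
      split_ifs <;> simp [Finset.card_erase_of_mem]
    simp only [h2]
    rw [Finset.prod_ite_mem]
    simp
  rw [Finset.card_eq_sum_card_fiberwise
    (f := fun v : Fin r → F => Finset.univ.filter fun a => v a ≠ 0)
    (t := (Finset.univ : Finset (Fin r)).powerset) (fun v _ => by simp)]
  have step : ∀ S : Finset (Fin r),
      ((Finset.univ.filter fun v : Fin r → F => v i ≠ 0 ∧
        k ≤ (Finset.univ.filter fun a => v a ≠ 0).card).filter
        (fun v => (Finset.univ.filter fun a => v a ≠ 0) = S)).card =
      if i ∈ S ∧ k ≤ S.card then (Fintype.card F - 1) ^ S.card else 0 := by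
    intro S
    rw [Finset.filter_filter]
    split_ifs with h
    · rw [← fib S]
      congr 1
      ext v
      simp only [Finset.mem_filter, Finset.mem_univ, true_and]
      refine ⟨fun h' => h'.2, fun h' => ⟨⟨?_, ?_⟩, h'⟩⟩
      · have := h.1
        rw [← h'] at this
        simpa using this
      · rw [h']; exact h.2
    · rw [Finset.card_eq_zero, Finset.filter_eq_empty_iff]
      rintro v - ⟨⟨h1, h2⟩, h3⟩
      apply h
      rw [← h3]
      exact ⟨by simpa using h1, h2⟩
  rw [Finset.sum_congr rfl (fun S _ => step S)]
  rw [← Finset.insert_erase (Finset.mem_univ i),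
    Finset.sum_powerset_insert (Finset.notMem_erase i _)]
  have z : ∑ t ∈ (Finset.univ.erase i).powerset,
      (if i ∈ t ∧ k ≤ t.card then (Fintype.card F - 1) ^ t.card else 0) = 0 := by
    refine Finset.sum_eq_zero fun t ht => if_neg ?_
    rintro ⟨h, -⟩
    exact Finset.notMem_erase i _ (Finset.mem_powerset.1 ht h)
  have y : ∑ t ∈ (Finset.univ.erase i).powerset,
      (if i ∈ insert i t ∧ k ≤ (insert i t).card
        then (Fintype.card F - 1) ^ (insert i t).card else 0) =
      ∑ t ∈ (Finset.univ.erase i).powerset,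
        (fun m => if k ≤ m + 1 then (Fintype.card F - 1) ^ (m + 1) else 0) t.card := by
    refine Finset.sum_congr rfl fun t ht => ?_
    have : i ∉ t := fun h => Finset.notMem_erase i _ (Finset.mem_powerset.1 ht h)
    simp [Finset.card_insert_of_notMem this]
  rw [z, y, zero_add, Finset.sum_powerset_apply_card
    (fun m => if k ≤ m + 1 then (Fintype.card F - 1) ^ (m + 1) else 0)]
  have hc : (Finset.univ.erase i).card = r - 1 := by
    simp [Finset.card_erase_of_mem]
  rw [hc, Finset.mul_sum]
  symm
  refine Finset.sum_subset_zero_on_sdiff ?_ ?_ ?_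
  · intro a; simp only [Finset.mem_Icc, Finset.mem_range]; omega
  · intro a ha
    simp only [Finset.mem_sdiff, Finset.mem_Icc, Finset.mem_range] at ha
    rw [if_neg (by omega), smul_zero]
  · intro a ha
    simp only [Finset.mem_Icc] at ha
    rw [if_pos (by omega), smul_eq_mul]
    ring

/-- For `1 ≤ k₁ ≤ r/2`, `1 ≤ k₂ ≤ s/2` and fixed indices `i, j`, the set of vertices
containing `α_i` and `β_j` in their skeleton and whose `U`- and `W`-skeletons have
at least `k₁` resp. `k₂` elements is a clique, of the stated cardinality. -/
theorem directSumGraph_clique_card_one (F : Type*) [Field F] [Fintype F] [DecidableEq F]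
    (q r s k₁ k₂ : ℕ) (hq : Fintype.card F = q)
    (hk₁ : 1 ≤ k₁) (hk₁r : 2 * k₁ ≤ r) (hk₂ : 1 ≤ k₂) (hk₂s : 2 * k₂ ≤ s)
    (i : Fin r) (j : Fin s) :
    (directSumGraph F r s).IsClique
      {x | x.val.1 i ≠ 0 ∧ x.val.2 j ≠ 0 ∧
        k₁ ≤ (Finset.univ.filter fun a => x.val.1 a ≠ 0).card ∧
        k₂ ≤ (Finset.univ.filter fun b => x.val.2 b ≠ 0).card} ∧
    ({x | x.val.1 i ≠ 0 ∧ x.val.2 j ≠ 0 ∧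
        k₁ ≤ (Finset.univ.filter fun a => x.val.1 a ≠ 0).card ∧
        k₂ ≤ (Finset.univ.filter fun b => x.val.2 b ≠ 0).card} :
          Set {x : (Fin r → F) × (Fin s → F) // x.1 ≠ 0 ∧ x.2 ≠ 0}).ncard =
      (q - 1) ^ 2 * ∑ a ∈ Finset.Icc (k₁ - 1) (r - 1), ∑ b ∈ Finset.Icc (k₂ - 1) (s - 1),
        (r - 1).choose a * (s - 1).choose b * (q - 1) ^ (a + b) := by
  constructor
  · intro x hx y hy hxy
    exact ⟨hxy, ⟨i, hx.1, hy.1⟩, ⟨j, hx.2.1, hy.2.1⟩⟩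
  · rw [← Set.ncard_image_of_injective _ Subtype.val_injective]
    have e : (Subtype.val '' ({x | x.val.1 i ≠ 0 ∧ x.val.2 j ≠ 0 ∧
        k₁ ≤ (Finset.univ.filter fun a => x.val.1 a ≠ 0).card ∧
        k₂ ≤ (Finset.univ.filter fun b => x.val.2 b ≠ 0).card} :
          Set {x : (Fin r → F) × (Fin s → F) // x.1 ≠ 0 ∧ x.2 ≠ 0})) =
        (((Finset.univ.filter fun v : Fin r → F => v i ≠ 0 ∧
          k₁ ≤ (Finset.univ.filter fun a => v a ≠ 0).card) ×ˢ
        (Finset.univ.filter fun v : Fin s → F => v j ≠ 0 ∧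
          k₂ ≤ (Finset.univ.filter fun a => v a ≠ 0).card) :
          Finset ((Fin r → F) × (Fin s → F))) : Set ((Fin r → F) × (Fin s → F))) := by
      ext x
      simp only [Set.mem_image, Set.mem_setOf_eq, Finset.mem_coe, Finset.mem_product,
        Finset.mem_filter, Finset.mem_univ, true_and]
      constructor
      · rintro ⟨y, ⟨h1, h2, h3, h4⟩, rfl⟩
        exact ⟨⟨h1, h3⟩, h2, h4⟩
      · rintro ⟨⟨h1, h3⟩, h2, h4⟩
        exact ⟨⟨x, fun h => h1 (by rw [h]; rfl), fun h => h2 (by rw [h]; rfl)⟩,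
          ⟨h1, h2, h3, h4⟩, rfl⟩
    rw [e, Set.ncard_coe_finset, Finset.card_product, aux_count F r k₁ hk₁ i,
      aux_count F s k₂ hk₂ j, hq, mul_mul_mul_comm, Finset.sum_mul_sum, ← sq]
    congr 1
    refine Finset.sum_congr rfl fun a _ => Finset.sum_congr rfl fun b _ => ?_
    ring
end
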